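/- Let S = {S_i}_{i∈E} be a rotation-free similarity IFS on ℝ^d satisfying the open set condition, with attractor C of similarity dimension s, and let μ be the normalized measure H^s(C)^{-1}·H^s⌊C. Let k(x,y) = Ω(x−y)/|x−y|^s be an s-homogeneous kernel. Suppose there is a finite word w ∈ E^* such that, writing x_w for the unique fixed point of S_w, the function y ↦ k(x_w,y) is μ-integrable on C∖C_w and ∫_{C∖C_w} k(x_w,y) dμ(y) ≠ 0. Then for μ̃-almost every v ∈ E^ℕ one has T_sy*(1)(v) = ∞, i.e. for every M > 0 there exist m < n such that |∫*_{C_{v|_m}∖C_{v|_n}} k(π(v),y) dμ(y)| > M. -/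

import Mathlib

open MeasureTheory Metric Set Filter
open scoped ENNReal Topology NNReal

noncomputable section

/-- Euclidean space `ℝ^d`. -/
abbrev Euc (d : ℕ) := EuclideanSpace ℝ (Fin d)

/-- Composition `S_w = S_{w_1} ∘ ⋯ ∘ S_{w_n}` along a finite word. -/
def Sw {d N : ℕ} (S : Fin N → Euc d → Euc d) : List (Fin N) → Euc d → Euc d
  | [] => id
  | i :: t => S i ∘ Sw S t

/-- The finite word `w|_k = w_1 ⋯ w_k` of an infinite word. -/
def word {N : ℕ} (w : ℕ → Fin N) (k : ℕ) : List (Fin N) :=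
  List.ofFn (fun j : Fin k => w j)

/-- Distance between two sets. -/
def setDist {X : Type*} [PseudoMetricSpace X] (A B : Set X) : ℝ :=
  sInf (Set.image2 dist A B)

/-- The word `w` repeated `m` times. -/
def wrep {N : ℕ} (w : List (Fin N)) (m : ℕ) : List (Fin N) :=
  (List.replicate m w).flatten

/-- The unit vector `(x - ξ)/|x - ξ|`, as a point of the unit sphere. -/
def sphN {d : ℕ} (ξ x : Euc d) (h : x ≠ ξ) : sphere (0 : Euc d) 1 :=
  ⟨‖x - ξ‖⁻¹ • (x - ξ), by
    have hx : x - ξ ≠ 0 := sub_ne_zero.mpr h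
    simp [mem_sphere_iff_norm, norm_smul, abs_of_nonneg,
      inv_mul_cancel₀ (norm_ne_zero_iff.mpr hx)]⟩

/-- The starred integral: the integral if the integrand is integrable on the set, else `0`. -/
def starInt {X : Type*} [MeasurableSpace X] (μ : Measure X) (A : Set X) (g : X → ℝ) : ℝ :=
  @ite _ (IntegrableOn g A μ) (Classical.dec _) (∫ y in A, g y ∂μ) 0

section Words

variable {d N : ℕ} {q : Fin N → Euc d} {r : Fin N → ℝ} {S : Fin N → Euc d → Euc d}

/-- The contraction ratio `r_u = r_{u_1} ⋯ r_{u_n}` of `S_u`. -/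
def ratio (r : Fin N → ℝ) (u : List (Fin N)) : ℝ := (u.map r).prod

lemma ratio_append (u v : List (Fin N)) : ratio r (u ++ v) = ratio r u * ratio r v := by
  simp [ratio]

lemma ratio_cons (i : Fin N) (v : List (Fin N)) : ratio r (i :: v) = r i * ratio r v := by
  simp [ratio]

lemma ratio_pos (hr : ∀ i, r i ∈ Set.Ioo (0 : ℝ) 1) (u : List (Fin N)) : 0 < ratio r u := by
  induction u with
  | nil => simp [ratio]
  | cons i t ih => rw [ratio_cons]; exact mul_pos (hr i).1 ih

lemma ratio_le_pow (hr : ∀ i, r i ∈ Set.Ioo (0 : ℝ) 1) {b : ℝ} (hb : ∀ i, r i ≤ b)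
    (u : List (Fin N)) : ratio r u ≤ b ^ u.length := by
  induction u with
  | nil => simp [ratio]
  | cons i t ih =>
    rw [ratio_cons, List.length_cons, pow_succ']
    exact mul_le_mul (hb i) ih (ratio_pos hr t).le ((hr i).1.le.trans (hb i))

lemma ratio_le_one (hr : ∀ i, r i ∈ Set.Ioo (0 : ℝ) 1) (u : List (Fin N)) : ratio r u ≤ 1 := by
  simpa using ratio_le_pow hr (b := 1) (fun i => (hr i).2.le) u

lemma ratio_lt_one (hr : ∀ i, r i ∈ Set.Ioo (0 : ℝ) 1) {u : List (Fin N)} (hu : u ≠ []) :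
    ratio r u < 1 := by
  cases u with
  | nil => exact absurd rfl hu
  | cons i t =>
    rw [ratio_cons]
    nlinarith [(hr i).1, (hr i).2, ratio_le_one hr t, ratio_pos hr t]

lemma wrep_succ (w : List (Fin N)) (n : ℕ) : wrep w (n + 1) = w ++ wrep w n := by
  simp [wrep, List.replicate_succ]

lemma wrep_add (w : List (Fin N)) (m n : ℕ) : wrep w (m + n) = wrep w m ++ wrep w n := by
  simp only [wrep, List.replicate_add, List.flatten_append]

lemma wrep_one (w : List (Fin N)) : wrep w 1 = w := by
  simp [wrep]

lemma length_wrep (w : List (Fin N)) (n : ℕ) : (wrep w n).length = n * w.length := by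
  simp [wrep]

lemma ratio_wrep (w : List (Fin N)) (n : ℕ) : ratio r (wrep w n) = ratio r w ^ n := by
  induction n with
  | zero => simp [wrep, ratio]
  | succ n ih => rw [wrep_succ, ratio_append, ih, pow_succ']

lemma Sw_append (u v : List (Fin N)) : Sw S (u ++ v) = Sw S u ∘ Sw S v := by
  induction u with
  | nil => rfl
  | cons i t ih => simp [Sw, ih, Function.comp_assoc]

lemma Sw_append_image (u v : List (Fin N)) (A : Set (Euc d)) :
    Sw S (u ++ v) '' A = Sw S u '' (Sw S v '' A) := by
  rw [Sw_append, image_comp]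

lemma Sw_sub (hS : ∀ i x, S i x = q i + r i • x) (u : List (Fin N)) (x y : Euc d) :
    Sw S u x - Sw S u y = ratio r u • (x - y) := by
  induction u with
  | nil => simp [Sw, ratio]
  | cons i t ih =>
    simp only [Sw, Function.comp_apply, hS, add_sub_add_left_eq_sub, ← smul_sub, ih, ratio_cons,
      mul_smul]

lemma Sw_apply (hS : ∀ i x, S i x = q i + r i • x) (u : List (Fin N)) (x : Euc d) :
    Sw S u x = Sw S u 0 + ratio r u • x := by
  have := Sw_sub hS u x 0
  rw [sub_zero] at this
  rw [← this]; abel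

lemma dist_Sw (hr : ∀ i, r i ∈ Set.Ioo (0 : ℝ) 1) (hS : ∀ i x, S i x = q i + r i • x)
    (u : List (Fin N)) (x y : Euc d) :
    dist (Sw S u x) (Sw S u y) = ratio r u * dist x y := by
  rw [dist_eq_norm, Sw_sub hS, norm_smul, Real.norm_of_nonneg (ratio_pos hr u).le, dist_eq_norm]

lemma Sw_injective (hr : ∀ i, r i ∈ Set.Ioo (0 : ℝ) 1) (hS : ∀ i x, S i x = q i + r i • x)
    (u : List (Fin N)) : Function.Injective (Sw S u) := by
  intro x y h
  have := dist_Sw hr hS u x y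
  rw [h, dist_self, eq_comm, mul_eq_zero] at this
  exact dist_eq_zero.1 (this.resolve_left (ratio_pos hr u).ne')

lemma continuous_Sw (hS : ∀ i x, S i x = q i + r i • x) (u : List (Fin N)) :
    Continuous (Sw S u) := by
  rw [funext (Sw_apply hS u)]
  fun_prop

lemma Sw_wrep_fixed {w : List (Fin N)} {x : Euc d} (hx : Sw S w x = x) (n : ℕ) :
    Sw S (wrep w n) x = x := by
  induction n with
  | zero => rfl
  | succ n ih => rw [wrep_succ, Sw_append, Function.comp_apply, ih, hx]

lemma Sw_image_subset {A : Set (Euc d)} (hA : ∀ i, S i '' A ⊆ A) (u : List (Fin N)) :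
    Sw S u '' A ⊆ A := by
  induction u with
  | nil => simp [Sw]
  | cons i t ih =>
    rw [Sw, image_comp]
    exact (image_mono ih).trans (hA i)

lemma Sw_append_image_subset {A : Set (Euc d)} (hA : ∀ i, S i '' A ⊆ A) (u v : List (Fin N)) :
    Sw S (u ++ v) '' A ⊆ Sw S u '' A := by
  rw [Sw_append_image]
  exact image_mono (Sw_image_subset hA v)

lemma disjoint_Sw_image (hr : ∀ i, r i ∈ Set.Ioo (0 : ℝ) 1) (hS : ∀ i x, S i x = q i + r i • x)
    {O : Set (Euc d)} (hOsub : ∀ i, S i '' O ⊆ O)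
    (hOdisj : ∀ i j, i ≠ j → Disjoint (S i '' O) (S j '' O)) :
    ∀ u v : List (Fin N), u.length = v.length → u ≠ v → Disjoint (Sw S u '' O) (Sw S v '' O)
  | [], [], _, h => absurd rfl h
  | [], _ :: _, h, _ => by simp at h
  | _ :: _, [], h, _ => by simp at h
  | i :: u, j :: v, hl, hne => by
    rw [Sw, Sw, image_comp, image_comp]
    by_cases hij : i = j
    · subst hij
      have hinj : Function.Injective (S i) := Sw_injective hr hS [i]
      refine (disjoint_image_iff hinj).2 (disjoint_Sw_image hr hS hOsub hOdisj u v ?_ ?_)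
      · simpa using hl
      · rintro rfl
        exact hne rfl
    · exact (hOdisj i j hij).mono (image_mono (Sw_image_subset hOsub u))
        (image_mono (Sw_image_subset hOsub v))

lemma exists_mem_Sw_image_of_length {C : Set (Euc d)} (hC : C = ⋃ i, S i '' C) (n : ℕ) :
    ∀ x ∈ C, ∃ u : List (Fin N), u.length = n ∧ x ∈ Sw S u '' C := by
  induction n with
  | zero => exact fun x hx => ⟨[], rfl, by simpa [Sw] using hx⟩
  | succ n ih =>
    intro x hx
    rw [hC] at hx
    obtain ⟨i, y, hy, rfl⟩ := mem_iUnion.1 hx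
    obtain ⟨u, hu, z, hz, rfl⟩ := ih y hy
    exact ⟨i :: u, by simp [hu], z, hz, rfl⟩

lemma exists_mem_Sw_image_of_ratio (hr : ∀ i, r i ∈ Set.Ioo (0 : ℝ) 1)
    {C : Set (Euc d)} (hC : C = ⋃ i, S i '' C) {a b : ℝ} (ha : ∀ i, a ≤ r i)
    (hb : ∀ i, r i ≤ b) (hb1 : b < 1) (ha0 : 0 < a) {R : ℝ} (hR0 : 0 < R)
    (hR1 : R ≤ 1) {x : Euc d} (hx : x ∈ C) :
    ∃ u : List (Fin N), x ∈ Sw S u '' C ∧ a * R ≤ ratio r u ∧ ratio r u ≤ R := by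
  by_contra! hcon
  have key : ∀ n : ℕ, ∃ u : List (Fin N), u.length = n ∧ x ∈ Sw S u '' C ∧ R ≤ ratio r u := by
    intro n
    induction n with
    | zero => exact ⟨[], rfl, by simpa [Sw] using hx, by simpa [ratio] using hR1⟩
    | succ n ih =>
      obtain ⟨u, hu, ⟨y, hy, rfl⟩, hRu⟩ := ih
      rw [hC] at hy
      obtain ⟨i, z, hz, rfl⟩ := mem_iUnion.1 hy
      have hmem : Sw S u (S i z) ∈ Sw S (u ++ [i]) '' C :=
        ⟨z, hz, by simp [Sw_append, Sw]⟩
      have hra : ratio r (u ++ [i]) = ratio r u * r i := by simp [ratio]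
      refine ⟨u ++ [i], by simp [hu], hmem, (hcon _ hmem ?_).le⟩
      rw [hra, mul_comm]
      exact mul_le_mul hRu (ha i) ha0.le (ratio_pos hr u).le
  obtain ⟨n, hn⟩ := exists_pow_lt_of_lt_one hR0 hb1
  obtain ⟨u, hu, -, hRu⟩ := key n
  have := ratio_le_pow hr hb u
  rw [hu] at this
  linarith

/-- Under the open set condition the fixed point of `S_w` lies in no other cylinder set of the same
level. -/
lemma fixedPoint_notMem_Sw_image (hr : ∀ i, r i ∈ Set.Ioo (0 : ℝ) 1)
    (hS : ∀ i x, S i x = q i + r i • x)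
    {C : Set (Euc d)} (hCcomp : IsCompact C) (hC : C = ⋃ i, S i '' C)
    {O : Set (Euc d)} (hOop : IsOpen O) (hOne : O.Nonempty) (hOsub : ∀ i, S i '' O ⊆ O)
    (hOdisj : ∀ i j, i ≠ j → Disjoint (S i '' O) (S j '' O))
    {w u : List (Fin N)} {x : Euc d} (hx : Sw S w x = x) (hlen : u.length = w.length)
    (hne : u ≠ w) : x ∉ Sw S u '' C := by
  rintro ⟨c, hc, hcx⟩
  have hNne : Nonempty (Fin N) := by
    rw [hC] at hc
    exact (mem_iUnion.1 hc).nonempty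
  obtain ⟨i₀, hi₀⟩ := Finite.exists_min r
  obtain ⟨j₀, hj₀⟩ := Finite.exists_max r
  set a := r i₀ with ha
  have ha0 : 0 < a := (hr i₀).1
  obtain ⟨A, hA⟩ := hCcomp.isBounded.exists_norm_le
  obtain ⟨o, ho⟩ := hOne
  obtain ⟨ε, hε, hball⟩ := Metric.isOpen_iff.1 hOop o ho
  obtain ⟨T, -, hTfin, hT⟩ := (isCompact_closedBall (0 : Euc d) (‖o‖ + A)).finite_cover_balls
    (e := a * ε / 2) (by positivity)
  set p := hTfin.toFinset.card with hp
  have hw0 := ratio_pos hr w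
  have hw1 := ratio_le_one hr w
  have hu0 := ratio_pos hr u
  set R := ratio r w ^ p * ratio r u with hR
  have hR0 : 0 < R := by positivity
  have hτ : ∀ l : ℕ, l ≤ p → ∃ t : List (Fin N), c ∈ Sw S t '' C ∧
      a * R ≤ ratio r (wrep w l ++ (u ++ t)) ∧ ratio r (wrep w l ++ (u ++ t)) ≤ R := by
    intro l hl
    obtain ⟨t, ht, h1, h2⟩ := exists_mem_Sw_image_of_ratio hr hC (a := a) hi₀ hj₀
      (hr j₀).2 ha0 (R := ratio r w ^ (p - l)) (by positivity) (pow_le_one₀ hw0.le hw1) hc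
    have hRl : R = ratio r w ^ l * ratio r u * ratio r w ^ (p - l) := by
      rw [hR, mul_right_comm, ← pow_add, Nat.add_sub_cancel' hl]
    have hrat : ratio r (wrep w l ++ (u ++ t)) = ratio r w ^ l * ratio r u * ratio r t := by
      rw [ratio_append, ratio_append, ratio_wrep, mul_assoc]
    refine ⟨t, ht, ?_, ?_⟩
    · rw [hrat, hRl, mul_left_comm]; gcongr
    · rw [hrat, hRl]; gcongr
  choose! t htc hta htR using hτ
  set P : ℕ → Euc d := fun l => Sw S (wrep w l ++ (u ++ t l)) o with hP
  have hPx : ∀ l ≤ p, R⁻¹ • (P l - x) ∈ closedBall (0 : Euc d) (‖o‖ + A) := by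
    intro l hl
    obtain ⟨e, he, hee⟩ := htc l hl
    have hxe : x = Sw S (wrep w l ++ (u ++ t l)) e := by
      simp only [Sw_append, Function.comp_apply, hee, hcx, Sw_wrep_fixed hx]
    have hsub : P l - x = ratio r (wrep w l ++ (u ++ t l)) • (o - e) := by
      conv_lhs => rw [hxe]
      exact Sw_sub hS _ _ _
    rw [mem_closedBall_zero_iff, norm_smul, hsub, norm_smul, norm_inv, Real.norm_of_nonneg hR0.le,
      Real.norm_of_nonneg (ratio_pos hr _).le]
    have h1 : ‖o - e‖ ≤ ‖o‖ + A := (norm_sub_le _ _).trans (by gcongr; exact hA e he)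
    calc R⁻¹ * (ratio r (wrep w l ++ (u ++ t l)) * ‖o - e‖) ≤ R⁻¹ * (R * (‖o‖ + A)) := by
          gcongr; exact htR l hl
      _ = ‖o‖ + A := by field_simp
  have hcover : ∀ l ≤ p, ∃ y ∈ T, R⁻¹ • (P l - x) ∈ ball y (a * ε / 2) := by
    intro l hl
    simpa using hT (hPx l hl)
  choose! y hyT hy using hcover
  obtain ⟨l, hl, l', hl', hll, hyy⟩ := Finset.exists_ne_map_eq_of_card_lt_of_maps_to
    (s := Finset.range (p + 1)) (t := hTfin.toFinset) (f := y) (by simp [hp]) (by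
      intro l hl
      simpa using hyT l (by simpa [Nat.lt_succ_iff] using hl))
  have hlp : l ≤ p := by simpa [Nat.lt_succ_iff] using hl
  have hlp' : l' ≤ p := by simpa [Nat.lt_succ_iff] using hl'
  have hPP : dist (P l) (P l') < a * R * ε := by
    have h1 := hy l hlp
    have h2 := hy l' hlp'
    rw [← hyy] at h2
    have h3 : dist (R⁻¹ • (P l - x)) (R⁻¹ • (P l' - x)) < a * ε :=
      (dist_triangle_right _ _ (y l)).trans_lt (by
        rw [mem_ball] at h1 h2
        linarith)
    rw [dist_smul₀, dist_sub_right, norm_inv, Real.norm_of_nonneg hR0.le,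
      inv_mul_lt_iff₀ hR0] at h3
    linarith
  have hdisj : ∀ m m' : ℕ, m < m' → Disjoint (Sw S (wrep w m ++ (u ++ t m)) '' O)
      (Sw S (wrep w m' ++ (u ++ t m')) '' O) := by
    intro m m' hmm
    obtain ⟨n, rfl⟩ := Nat.exists_eq_add_of_lt hmm
    have : wrep w (m + n + 1) ++ (u ++ t (m + n + 1)) =
        wrep w m ++ (w ++ (wrep w n ++ (u ++ t (m + n + 1)))) := by
      rw [add_assoc, wrep_add, wrep_succ]
      simp only [List.append_assoc]
    rw [this, Sw_append_image (wrep w m), Sw_append_image (wrep w m),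
      disjoint_image_iff (Sw_injective hr hS _)]
    exact (disjoint_Sw_image hr hS hOsub hOdisj u w hlen hne).mono
      (Sw_append_image_subset hOsub _ _) (Sw_append_image_subset hOsub _ _)
  have hdisj' : Disjoint (Sw S (wrep w l ++ (u ++ t l)) '' O)
      (Sw S (wrep w l' ++ (u ++ t l')) '' O) := by
    rcases lt_or_gt_of_ne hll with h | h
    · exact hdisj _ _ h
    · exact (hdisj _ _ h).symm
  have hρ := ratio_pos hr (wrep w l ++ (u ++ t l))
  set ρ := ratio r (wrep w l ++ (u ++ t l)) with hρdef
  refine Set.disjoint_left.1 hdisj' (?_ : P l' ∈ _) ⟨o, ho, rfl⟩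
  refine ⟨o + ρ⁻¹ • (P l' - P l), hball ?_, ?_⟩
  · rw [mem_ball, dist_self_add_left, norm_smul, norm_inv, Real.norm_of_nonneg hρ.le,
      inv_mul_lt_iff₀ hρ, ← dist_eq_norm, dist_comm]
    exact hPP.trans_le (by gcongr; exact hta l hlp)
  · have h := Sw_sub hS (wrep w l ++ (u ++ t l)) (o + ρ⁻¹ • (P l' - P l)) o
    rw [add_sub_cancel_left, ← hρdef, smul_inv_smul₀ hρ.ne', sub_left_inj] at h
    exact h

end Words

section Scaling

variable {d N : ℕ} {q : Fin N → Euc d} {r : Fin N → ℝ} {S : Fin N → Euc d → Euc d}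

open scoped Pointwise in
lemma hausdorffMeasure_add_smul_image {s : ℝ} (hs : 0 ≤ s) (a : Euc d) {ρ : ℝ} (hρ : 0 < ρ)
    (A : Set (Euc d)) :
    μH[s] ((fun x => a + ρ • x) '' A) = ENNReal.ofReal (ρ ^ s) * μH[s] A := by
  have h1 : (fun x => a + ρ • x) '' A = (IsometryEquiv.addLeft a) '' (ρ • A) := by
    rw [← image_smul, image_image]
    rfl
  rw [h1, IsometryEquiv.hausdorffMeasure_image, Measure.hausdorffMeasure_smul₀ hs hρ.ne',
    ENNReal.smul_def, smul_eq_mul]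
  congr 1
  rw [← ENNReal.ofReal_rpow_of_pos hρ, ← ENNReal.ofReal_coe_nnreal]
  simp [ENNReal.ofReal_rpow_of_pos hρ, abs_of_pos hρ]

lemma measurableEmbedding_Sw (hr : ∀ i, r i ∈ Set.Ioo (0 : ℝ) 1)
    (hS : ∀ i x, S i x = q i + r i • x) (u : List (Fin N)) : MeasurableEmbedding (Sw S u) :=
  (continuous_Sw hS u).measurableEmbedding (Sw_injective hr hS u)

lemma restrict_Sw_image (hr : ∀ i, r i ∈ Set.Ioo (0 : ℝ) 1)
    (hS : ∀ i x, S i x = q i + r i • x) {s : ℝ} (hs : 0 ≤ s) {C : Set (Euc d)}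
    (hsub : ∀ i, S i '' C ⊆ C) {c : ℝ≥0∞} {μ : Measure (Euc d)}
    (hμ : μ = c • μH[s].restrict C) {A : Set (Euc d)} (hA : MeasurableSet A) (hAC : A ⊆ C)
    (u : List (Fin N)) :
    μ.restrict (Sw S u '' A) =
      ENNReal.ofReal (ratio r u ^ s) • (μ.restrict A).map (Sw S u) := by
  have hemb := measurableEmbedding_Sw hr hS u
  have hfA : MeasurableSet (Sw S u '' A) := hemb.measurableSet_image.2 hA
  have hfAC : Sw S u '' A ⊆ C := (image_mono hAC).trans (Sw_image_subset hsub u)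
  ext B hB
  have hpre : MeasurableSet (Sw S u ⁻¹' B) := hemb.measurable hB
  have h1 : B ∩ Sw S u '' A = Sw S u '' (Sw S u ⁻¹' B ∩ A) := by
    rw [image_preimage_inter]
  have h2 : μH[s] (Sw S u '' (Sw S u ⁻¹' B ∩ A)) =
      ENNReal.ofReal (ratio r u ^ s) * μH[s] (Sw S u ⁻¹' B ∩ A) := by
    rw [← hausdorffMeasure_add_smul_image hs (Sw S u 0) (ratio_pos hr u),
      ← funext (Sw_apply hS u)]
  rw [Measure.restrict_apply hB, Measure.smul_apply, Measure.map_apply hemb.measurable hB,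
    Measure.restrict_apply hpre, hμ, Measure.smul_apply, Measure.smul_apply,
    Measure.restrict_apply (hB.inter hfA), Measure.restrict_apply (hpre.inter hA),
    inter_eq_left.2 (inter_subset_right.trans hfAC),
    inter_eq_left.2 (inter_subset_right.trans hAC), h1, h2, smul_eq_mul, smul_eq_mul, smul_eq_mul,
    mul_left_comm]

lemma kernel_Sw (hr : ∀ i, r i ∈ Set.Ioo (0 : ℝ) 1)
    (hS : ∀ i x, S i x = q i + r i • x) {s : ℝ} (hs : 0 < s) {Ω : Euc d → ℝ}
    (hΩhom : ∀ c : ℝ, 0 < c → ∀ x, x ≠ 0 → Ω (c • x) = Ω x) (u : List (Fin N)) (z y : Euc d) :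
    Ω (Sw S u z - Sw S u y) / ‖Sw S u z - Sw S u y‖ ^ s =
      (ratio r u ^ s)⁻¹ * (Ω (z - y) / ‖z - y‖ ^ s) := by
  have hρ := ratio_pos hr u
  rw [Sw_sub hS]
  rcases eq_or_ne (z - y) 0 with h | h
  · simp [h, Real.zero_rpow hs.ne']
  · rw [hΩhom _ hρ _ h, norm_smul, Real.norm_of_nonneg hρ.le,
      Real.mul_rpow hρ.le (norm_nonneg _), div_eq_mul_inv, mul_inv]
    ring

lemma integrableOn_kernel_Sw_image (hr : ∀ i, r i ∈ Set.Ioo (0 : ℝ) 1)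
    (hS : ∀ i x, S i x = q i + r i • x) {s : ℝ} (hs : 0 < s) {C : Set (Euc d)}
    (hsub : ∀ i, S i '' C ⊆ C) {c : ℝ≥0∞} {μ : Measure (Euc d)}
    (hμ : μ = c • μH[s].restrict C) {Ω : Euc d → ℝ}
    (hΩhom : ∀ c : ℝ, 0 < c → ∀ x, x ≠ 0 → Ω (c • x) = Ω x)
    {A : Set (Euc d)} (hA : MeasurableSet A) (hAC : A ⊆ C) (u : List (Fin N)) {z : Euc d}
    (h : IntegrableOn (fun y => Ω (z - y) / ‖z - y‖ ^ s) A μ) :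
    IntegrableOn (fun y => Ω (Sw S u z - y) / ‖Sw S u z - y‖ ^ s) (Sw S u '' A) μ := by
  rw [IntegrableOn, restrict_Sw_image hr hS hs.le hsub hμ hA hAC]
  refine Integrable.smul_measure ?_ ENNReal.ofReal_ne_top
  rw [(measurableEmbedding_Sw hr hS u).integrable_map_iff]
  refine (h.const_mul (ratio r u ^ s)⁻¹).congr (Eventually.of_forall fun y => ?_)
  exact (kernel_Sw hr hS hs hΩhom u z y).symm

lemma setIntegral_kernel_Sw_image (hr : ∀ i, r i ∈ Set.Ioo (0 : ℝ) 1)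
    (hS : ∀ i x, S i x = q i + r i • x) {s : ℝ} (hs : 0 < s) {C : Set (Euc d)}
    (hsub : ∀ i, S i '' C ⊆ C) {c : ℝ≥0∞} {μ : Measure (Euc d)}
    (hμ : μ = c • μH[s].restrict C) {Ω : Euc d → ℝ}
    (hΩhom : ∀ c : ℝ, 0 < c → ∀ x, x ≠ 0 → Ω (c • x) = Ω x)
    {A : Set (Euc d)} (hA : MeasurableSet A) (hAC : A ⊆ C) (u : List (Fin N)) (z : Euc d) :
    ∫ y in Sw S u '' A, Ω (Sw S u z - y) / ‖Sw S u z - y‖ ^ s ∂μ =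
      ∫ y in A, Ω (z - y) / ‖z - y‖ ^ s ∂μ := by
  have hρ : 0 < ratio r u ^ s := Real.rpow_pos_of_pos (ratio_pos hr u) s
  rw [restrict_Sw_image hr hS hs.le hsub hμ hA hAC, integral_smul_measure,
    (measurableEmbedding_Sw hr hS u).integral_map]
  simp only [kernel_Sw hr hS hs hΩhom u z]
  rw [integral_const_mul, ENNReal.toReal_ofReal hρ.le, smul_eq_mul, mul_inv_cancel_left₀ hρ.ne']

/-- Truncated singular integrals along `u, uw, …, uwᴸ` are bounded below by `L` times a lower bound
of the integrals over `C ∖ C_w`. -/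
lemma integrableOn_and_le_setIntegral_wrep (hr : ∀ i, r i ∈ Set.Ioo (0 : ℝ) 1)
    (hS : ∀ i x, S i x = q i + r i • x) {s : ℝ} (hs : 0 < s) {C : Set (Euc d)}
    (hCcomp : IsCompact C) (hsub : ∀ i, S i '' C ⊆ C) {c : ℝ≥0∞} {μ : Measure (Euc d)}
    (hμ : μ = c • μH[s].restrict C) {Ω : Euc d → ℝ}
    (hΩhom : ∀ c : ℝ, 0 < c → ∀ x, x ≠ 0 → Ω (c • x) = Ω x)
    {w : List (Fin N)} {κ b : ℝ} (u : List (Fin N)) (Z : Euc d) (L : ℕ)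
    (hZ : ∀ l < L, ∃ z, Sw S (u ++ wrep w l) z = Z ∧
      IntegrableOn (fun y => Ω (z - y) / ‖z - y‖ ^ s) (C \ Sw S w '' C) μ ∧
      b ≤ κ * ∫ y in C \ Sw S w '' C, Ω (z - y) / ‖z - y‖ ^ s ∂μ) :
    IntegrableOn (fun y => Ω (Z - y) / ‖Z - y‖ ^ s)
        (Sw S u '' C \ Sw S (u ++ wrep w L) '' C) μ ∧
      L * b ≤ κ * ∫ y in Sw S u '' C \ Sw S (u ++ wrep w L) '' C,
        Ω (Z - y) / ‖Z - y‖ ^ s ∂μ := by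
  have hmeas : ∀ v, MeasurableSet (Sw S v '' C) := fun v =>
    (hCcomp.image (continuous_Sw hS v)).measurableSet
  have hCm : MeasurableSet C := hCcomp.measurableSet
  induction L with
  | zero => simp [wrep]
  | succ L ih =>
    obtain ⟨ih1, ih2⟩ := ih fun l hl => hZ l (hl.trans (Nat.lt_succ_self L))
    obtain ⟨z, rfl, hz1, hz2⟩ := hZ L (Nat.lt_succ_self L)
    have himg : Sw S (u ++ wrep w L) '' (C \ Sw S w '' C) =
        Sw S (u ++ wrep w L) '' C \ Sw S (u ++ wrep w (L + 1)) '' C := by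
      rw [image_sdiff (Sw_injective hr hS _), wrep_add, wrep_one, ← List.append_assoc,
        Sw_append_image (u ++ wrep w L) w]
    have h1 := integrableOn_kernel_Sw_image hr hS hs hsub hμ hΩhom
      (hCm.diff (hmeas w)) sdiff_subset (u ++ wrep w L) hz1
    have h2 := setIntegral_kernel_Sw_image hr hS hs hsub hμ hΩhom
      (hCm.diff (hmeas w)) sdiff_subset (u ++ wrep w L) z
    rw [himg] at h1 h2
    have hnest1 : Sw S (u ++ wrep w L) '' C ⊆ Sw S u '' C := Sw_append_image_subset hsub _ _
    have hnest2 : Sw S (u ++ wrep w (L + 1)) '' C ⊆ Sw S (u ++ wrep w L) '' C := by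
      rw [wrep_add, ← List.append_assoc]
      exact Sw_append_image_subset hsub _ _
    have hun : Sw S u '' C \ Sw S (u ++ wrep w (L + 1)) '' C =
        (Sw S u '' C \ Sw S (u ++ wrep w L) '' C) ∪
          (Sw S (u ++ wrep w L) '' C \ Sw S (u ++ wrep w (L + 1)) '' C) :=
      (sdiff_union_sdiff_cancel hnest1 hnest2).symm
    rw [hun]
    refine ⟨ih1.union h1, ?_⟩
    rw [setIntegral_union (disjoint_sdiff_left.mono_right sdiff_subset)
      ((hmeas _).diff (hmeas _)) ih1 h1, h2, mul_add]
    push_cast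
    linarith

end Scaling

/-- If `k` is continuous off the origin, its integral over a bounded set `A` against a finite
measure depends continuously on the base point, away from `A`. -/
lemma integrableOn_and_continuousAt_setIntegral_sub {E : Type*} [NormedAddCommGroup E]
    [ProperSpace E] [MeasurableSpace E] [BorelSpace E] {k : E → ℝ}
    (hk : ContinuousOn k {x | x ≠ 0}) {μ : Measure E} [IsFiniteMeasure μ] {A : Set E}
    (hA : MeasurableSet A) (hbdd : Bornology.IsBounded A) {x : E} {δ : ℝ} (hδ : 0 < δ)
    (hdist : ∀ y ∈ A, δ ≤ dist x y) :
    (∀ᶠ z in 𝓝 x, IntegrableOn (fun y => k (z - y)) A μ) ∧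
      ContinuousAt (fun z => ∫ y in A, k (z - y) ∂μ) x := by
  obtain ⟨D, hD⟩ := hbdd.exists_norm_le
  have hKc : IsCompact ({v : E | δ / 2 ≤ ‖v‖} ∩ closedBall 0 (‖x‖ + δ / 2 + D)) :=
    (isCompact_closedBall _ _).inter_left (isClosed_le continuous_const continuous_norm)
  have hKsub : {v : E | δ / 2 ≤ ‖v‖} ∩ closedBall 0 (‖x‖ + δ / 2 + D) ⊆ {v | v ≠ 0} := by
    rintro v ⟨hv, -⟩ rfl
    simp only [mem_ofPred_eq, norm_zero] at hv
    linarith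
  obtain ⟨B, hB⟩ := hKc.exists_bound_of_continuousOn (hk.mono hKsub)
  have hnear : ∀ z ∈ ball x (δ / 2), ∀ y ∈ A,
      z - y ∈ {v : E | δ / 2 ≤ ‖v‖} ∩ closedBall 0 (‖x‖ + δ / 2 + D) := by
    intro z hz y hy
    rw [mem_ball] at hz
    constructor
    · have h1 := dist_triangle_left x y z
      have h2 := hdist y hy
      rw [mem_ofPred_eq, ← dist_eq_norm]
      linarith
    · rw [mem_closedBall_zero_iff]
      have h1 : ‖z‖ ≤ ‖x‖ + ‖z - x‖ := norm_le_norm_add_norm_sub' z x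
      rw [← dist_eq_norm] at h1
      linarith [norm_sub_le z y, hD y hy]
  have hball : ∀ᶠ z in 𝓝 x, z ∈ ball x (δ / 2) := ball_mem_nhds x (by positivity)
  have hmeas : ∀ z ∈ ball x (δ / 2),
      AEStronglyMeasurable (fun y => k (z - y)) (μ.restrict A) := fun z hz =>
    ContinuousOn.aestronglyMeasurable
      (hk.comp (by fun_prop) fun y hy => hKsub (hnear z hz y hy)) hA
  have hbound : ∀ z ∈ ball x (δ / 2), ∀ᵐ y ∂μ.restrict A, ‖k (z - y)‖ ≤ B := fun z hz =>
    (ae_restrict_iff' hA).2 (Eventually.of_forall fun y hy => hB _ (hnear z hz y hy))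
  constructor
  · filter_upwards [hball] with z hz
    exact Integrable.of_bound (hmeas z hz) B (hbound z hz)
  · refine continuousAt_of_dominated (bound := fun _ => B) (hball.mono hmeas) (hball.mono hbound)
      (integrable_const B) ?_
    refine (ae_restrict_iff' hA).2 (Eventually.of_forall fun y hy => ?_)
    have hne : x - y ≠ 0 := hKsub (hnear x (mem_ball_self (by positivity)) y hy)
    have hc : ContinuousAt k (x - y) := hk.continuousAt (isOpen_ne.mem_nhds hne)
    exact ContinuousAt.comp (f := fun z => z - y) hc (by fun_prop)

section Bernoulli

variable {N : ℕ}

lemma length_word (v : ℕ → Fin N) (k : ℕ) : (word v k).length = k := by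
  simp [word]

lemma exists_word_add (v : ℕ → Fin N) (m n : ℕ) :
    ∃ b : Fin n → Fin N, word v (m + n) = word v m ++ List.ofFn b := by
  refine ⟨fun j => v (m + j), ?_⟩
  simp only [word, List.ofFn_add]
  rfl

lemma word_prefix {v : ℕ → Fin N} {m : ℕ} {u t : List (Fin N)}
    (h : word v (m + (u ++ t).length) = word v m ++ (u ++ t)) :
    word v (m + u.length) = word v m ++ u := by
  rw [List.length_append, ← add_assoc] at h
  obtain ⟨b, hb⟩ := exists_word_add v (m + u.length) t.length
  rw [hb, ← List.append_assoc] at h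
  exact (List.append_inj' h (by simp)).1

/-- For a Bernoulli measure with positive weights, almost every sequence contains the word `W`. -/
lemma ae_exists_word_append {μt : Measure (ℕ → Fin N)} {f : Fin N → ℝ≥0∞}
    (hf0 : ∀ i, f i ≠ 0) (hf1 : ∑ i, f i = 1)
    (hμt : ∀ u : List (Fin N), μt {v | word v u.length = u} = (u.map f).prod)
    (W : List (Fin N)) :
    ∀ᵐ v ∂μt, ∃ m, word v (m + W.length) = word v m ++ W := by
  classical
  set ℓ := W.length with hℓ
  set g : (Fin ℓ → Fin N) → ℝ≥0∞ := fun b => ((List.ofFn b).map f).prod with hg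
  have hg1 : ∑ b, g b = 1 := by
    have : ∀ b, g b = ∏ i, f (b i) := fun b => by
      simp [hg, List.map_ofFn, List.prod_ofFn]
    simp only [this]
    rw [← Fintype.prod_sum (fun (_ : Fin ℓ) j => f j)]
    simp [hf1]
  set b₀ : Fin ℓ → Fin N := W.get with hb₀
  have hWb : List.ofFn b₀ = W := List.ofFn_get W
  set p := ∑ b ∈ Finset.univ.erase b₀, g b with hp
  have hp1 : p < 1 := by
    have hsum : g b₀ + p = 1 := by
      rw [hp, Finset.add_sum_erase _ _ (Finset.mem_univ _), hg1]
    have hpos : g b₀ ≠ 0 := by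
      simp only [hg]
      intro h
      rw [List.prod_eq_zero_iff] at h
      obtain ⟨i, -, hi⟩ := List.mem_map.1 h
      exact hf0 i hi
    have hptop : p ≠ ⊤ := fun h => by simp [h] at hsum
    rw [← hsum, add_comm]
    exact ENNReal.lt_add_right hptop hpos
  have key : ∀ (K : ℕ) (u : List (Fin N)),
      μt {v | word v u.length = u ∧ ∀ m, word v (m + ℓ) ≠ word v m ++ W} ≤
        (u.map f).prod * p ^ K := by
    intro K
    induction K with
    | zero =>
      intro u
      rw [pow_zero, mul_one, ← hμt u]
      exact measure_mono fun v hv => hv.1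
    | succ K ih =>
      intro u
      have hsub : {v : ℕ → Fin N | word v u.length = u ∧ ∀ m, word v (m + ℓ) ≠ word v m ++ W} ⊆
          ⋃ b ∈ Finset.univ.erase b₀, {v | word v (u ++ List.ofFn b).length = u ++ List.ofFn b ∧
            ∀ m, word v (m + ℓ) ≠ word v m ++ W} := by
        rintro v ⟨hv1, hv2⟩
        obtain ⟨b, hb⟩ := exists_word_add v u.length ℓ
        have hbne : b ≠ b₀ := by
          rintro rfl
          rw [hWb] at hb
          exact hv2 _ hb
        simp only [mem_iUnion]
        refine ⟨b, by simpa using hbne, ?_, hv2⟩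
        rw [List.length_append, List.length_ofFn, hb, hv1]
      calc _ ≤ _ := measure_mono hsub
        _ ≤ _ := measure_biUnion_finset_le _ _
        _ ≤ ∑ b ∈ Finset.univ.erase b₀, (u.map f).prod * g b * p ^ K := by
          refine Finset.sum_le_sum fun b _ => (ih _).trans ?_
          rw [List.map_append, List.prod_append]
        _ = _ := by
          rw [← Finset.sum_mul, ← Finset.mul_sum, pow_succ', mul_assoc]
  rw [ae_iff]
  have hlim : Tendsto (fun K : ℕ => p ^ K) atTop (𝓝 0) :=
    ENNReal.tendsto_pow_atTop_nhds_zero_of_lt_one hp1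
  refine le_antisymm (ge_of_tendsto' hlim fun K => ?_) zero_le
  refine (measure_mono ?_).trans ((key K []).trans (by simp))
  intro v hv
  refine ⟨by simp [word], ?_⟩
  simpa using hv

end Bernoulli

/-- (Criterion for unboundedness, symbolic form.) For a rotation-free similarity
IFS on `ℝ^d` satisfying the OSC, if at the fixed point `x_w` of some `S_w` the integral
`∫_{C∖C_w} k(x_w,y) dμ(y)` is finite and nonzero, then `T_sy*(1)(v) = ∞` for `μ̃`-a.e. `v`. -/
theorem stmt4
    {d N : ℕ} (hd : 1 ≤ d) (hN : 2 ≤ N)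
    (q : Fin N → Euc d) (r : Fin N → ℝ) (hr : ∀ i, r i ∈ Set.Ioo (0:ℝ) 1)
    (S : Fin N → Euc d → Euc d) (hS : ∀ i x, S i x = q i + r i • x)
    (C : Set (Euc d)) (hCne : C.Nonempty) (hCcomp : IsCompact C)
    (hCinv : C = ⋃ i, S i '' C)
    (O : Set (Euc d)) (hOop : IsOpen O) (hOne : O.Nonempty)
    (hOsub : ∀ i, S i '' O ⊆ O)
    (hOdisj : ∀ i j, i ≠ j → Disjoint (S i '' O) (S j '' O))
    (s : ℝ) (hs : 0 < s) (hdim : ∑ i, r i ^ s = 1)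
    (μ : Measure (Euc d)) (hμ : μ = (μH[s] C)⁻¹ • μH[s].restrict C)
    (π : (ℕ → Fin N) → Euc d)
    (hπ : ∀ w, (⋂ k, Sw S (word w k) '' C) = {π w})
    (μt : Measure (ℕ → Fin N)) [IsProbabilityMeasure μt]
    (hμt : ∀ u : List (Fin N),
      μt {w | word w u.length = u} = (u.map fun i => ENNReal.ofReal (r i ^ s)).prod)
    (Ω : Euc d → ℝ)
    (hΩc : ContinuousOn Ω {x | x ≠ 0})
    (hΩne : ∃ x, x ≠ 0 ∧ Ω x ≠ 0)
    (hΩhom : ∀ c : ℝ, 0 < c → ∀ x, x ≠ 0 → Ω (c • x) = Ω x)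
    (w : List (Fin N)) (hwne : w ≠ []) (xw : Euc d) (hxw : Sw S w xw = xw)
    (hint : IntegrableOn (fun y => Ω (xw - y) / ‖xw - y‖ ^ s) (C \ Sw S w '' C) μ)
    (hne : ∫ y in C \ Sw S w '' C, Ω (xw - y) / ‖xw - y‖ ^ s ∂μ ≠ 0) :
    ∀ᵐ v ∂μt, ∀ M : ℝ, 0 < M → ∃ m n : ℕ, m < n ∧
      M < |starInt μ (Sw S (word v m) '' C \ Sw S (word v n) '' C)
            (fun y => Ω (π v - y) / ‖π v - y‖ ^ s)| := by
  have hsub : ∀ i, S i '' C ⊆ C := fun i => by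
    conv_rhs => rw [hCinv]
    exact subset_iUnion (fun i => S i '' C) i
  have hμ0 : μ ≠ 0 := by
    rintro rfl
    simp at hne
  have hHtop : μH[s] C ≠ ⊤ := fun h => hμ0 (by simp [hμ, h])
  have hH0 : μH[s] C ≠ 0 := fun h => hμ0 (by rw [hμ, Measure.restrict_eq_zero.2 h, smul_zero])
  have hfin : IsFiniteMeasure μ := by
    refine ⟨?_⟩
    rw [hμ, Measure.smul_apply, Measure.restrict_apply_univ, smul_eq_mul]
    exact ENNReal.mul_lt_top (ENNReal.inv_lt_top.2 (pos_iff_ne_zero.2 hH0)) hHtop.lt_top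
  have hmeasA : MeasurableSet (C \ Sw S w '' C) :=
    hCcomp.measurableSet.diff (hCcomp.image (continuous_Sw hS w)).measurableSet
  set F : Set (Euc d) := ⋃ u ∈ {u : List (Fin N) | u.length = w.length ∧ u ≠ w}, Sw S u '' C
    with hF
  have hFclosed : IsClosed F := by
    refine Set.Finite.isClosed_biUnion ?_ fun u _ => (hCcomp.image (continuous_Sw hS u)).isClosed
    exact (List.finite_length_eq (Fin N) w.length).subset fun u hu => hu.1
  have hxF : xw ∉ F := by
    simp only [hF, mem_iUnion, not_exists]
    exact fun u hu =>
      fixedPoint_notMem_Sw_image hr hS hCcomp hCinv hOop hOne hOsub hOdisj hxw hu.1 hu.2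
  have hAF : C \ Sw S w '' C ⊆ F := by
    rintro y ⟨hyC, hyw⟩
    obtain ⟨u, hu, hyu⟩ := exists_mem_Sw_image_of_length hCinv w.length y hyC
    refine mem_iUnion₂.2 ⟨u, ⟨hu, ?_⟩, hyu⟩
    rintro rfl
    exact hyw hyu
  obtain ⟨δ, hδ, hδF⟩ := Metric.isOpen_iff.1 hFclosed.isOpen_compl xw hxF
  have hdist : ∀ y ∈ C \ Sw S w '' C, δ ≤ dist xw y := by
    intro y hy
    by_contra! hlt
    exact hδF (mem_ball'.2 hlt) (hAF hy)
  have hk : ContinuousOn (fun x => Ω x / ‖x‖ ^ s) {x | x ≠ 0} := by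
    refine hΩc.div (fun x hx => ?_) fun x hx =>
      (Real.rpow_pos_of_pos (norm_pos_iff.2 hx) s).ne'
    exact (continuous_norm.continuousAt.rpow_const
      (Or.inl (norm_ne_zero_iff.2 hx))).continuousWithinAt
  obtain ⟨hInt, hcont⟩ := integrableOn_and_continuousAt_setIntegral_sub (μ := μ) hk hmeasA
    (hCcomp.isBounded.subset sdiff_subset) hδ hdist
  set I := ∫ y in C \ Sw S w '' C, Ω (xw - y) / ‖xw - y‖ ^ s ∂μ with hI
  have hII : 0 < I * I := mul_self_pos.2 hne
  have hev : ∀ᶠ z in 𝓝 xw, I * I / 2 <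
      I * ∫ y in C \ Sw S w '' C, Ω (z - y) / ‖z - y‖ ^ s ∂μ :=
    (continuousAt_const.mul hcont).eventually (lt_mem_nhds (half_lt_self hII))
  obtain ⟨η, hη, hηball⟩ := Metric.eventually_nhds_iff.1 (hInt.and hev)
  obtain ⟨D, hD⟩ := hCcomp.isBounded.subset_closedBall xw
  obtain ⟨p₀, hp₀⟩ : ∃ p₀ : ℕ, ratio r w ^ p₀ * D < η := by
    have h := (tendsto_pow_atTop_nhds_zero_of_lt_one (ratio_pos hr w).le
      (ratio_lt_one hr hwne)).mul_const D
    rw [zero_mul] at h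
    exact (h.eventually (gt_mem_nhds hη)).exists
  have hf1 : ∑ i, ENNReal.ofReal (r i ^ s) = 1 := by
    rw [← ENNReal.ofReal_sum_of_nonneg fun i _ => Real.rpow_nonneg (hr i).1.le s, hdim,
      ENNReal.ofReal_one]
  have hae : ∀ᵐ v ∂μt, ∀ W : List (Fin N), ∃ m, word v (m + W.length) = word v m ++ W :=
    ae_all_iff.2 (ae_exists_word_append (fun i => (ENNReal.ofReal_pos.2
      (Real.rpow_pos_of_pos (hr i).1 s)).ne') hf1 hμt)
  filter_upwards [hae] with v hv M hM
  obtain ⟨L, hL⟩ := exists_nat_gt (2 * M / |I|)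
  have hI0 : 0 < |I| := abs_pos.2 hne
  have hL0 : 0 < L := by
    have : (0 : ℝ) < L := lt_of_le_of_lt (by positivity) hL
    exact_mod_cast this
  obtain ⟨m, hm⟩ := hv (wrep w (L + p₀))
  have hmL : word v (m + (wrep w L).length) = word v m ++ wrep w L := by
    rw [wrep_add] at hm
    exact word_prefix hm
  refine ⟨m, m + (wrep w L).length, ?_, ?_⟩
  · rw [length_wrep]
    exact Nat.lt_add_of_pos_right (Nat.mul_pos hL0 (List.length_pos_iff.2 hwne))
  have hπmem : π v ∈ Sw S (word v m ++ wrep w (L + p₀)) '' C := by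
    have h : π v ∈ ⋂ k, Sw S (word v k) '' C := by rw [hπ v]; rfl
    rw [← hm]
    exact mem_iInter.1 h _
  obtain ⟨c, hc, hcπ⟩ := hπmem
  obtain ⟨hint', hle⟩ := integrableOn_and_le_setIntegral_wrep hr hS hs hCcomp hsub hμ hΩhom
    (w := w) (κ := I) (b := I * I / 2) (word v m) (π v) L (by
      intro l hl
      obtain ⟨n, rfl⟩ := Nat.exists_eq_add_of_lt hl
      refine ⟨Sw S (wrep w (n + 1 + p₀)) c, ?_, ?_⟩
      · rw [← hcπ, ← Function.comp_apply (f := Sw S _) (g := Sw S _), ← Sw_append,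
          List.append_assoc, ← wrep_add, add_assoc l, add_assoc l]
      · have hz : dist (Sw S (wrep w (n + 1 + p₀)) c) xw < η := by
          have hfix := Sw_wrep_fixed hxw (n + 1 + p₀)
          calc dist (Sw S (wrep w (n + 1 + p₀)) c) xw
              = ratio r w ^ (n + 1 + p₀) * dist c xw := by
                rw [← ratio_wrep, ← dist_Sw hr hS, hfix]
            _ ≤ ratio r w ^ p₀ * D :=
                mul_le_mul (pow_le_pow_of_le_one (ratio_pos hr w).le (ratio_le_one hr w)
                  (Nat.le_add_left _ _)) (hD hc) dist_nonneg (pow_pos (ratio_pos hr w) _).le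
            _ < η := hp₀
        exact ⟨(hηball hz).1, (hηball hz).2.le⟩)
  rw [hmL, starInt, if_pos hint']
  set J := ∫ y in Sw S (word v m) '' C \ Sw S (word v m ++ wrep w L) '' C,
    Ω (π v - y) / ‖π v - y‖ ^ s ∂μ
  have h1 : I * J ≤ |I| * |J| := (le_abs_self _).trans (abs_mul I J).le
  rw [← abs_mul_abs_self I] at hle
  rw [div_lt_iff₀ hI0] at hL
  nlinarith
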